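/- There exists an absolute constant C₀ > 0 with the following property: for every arc J ⊆ 𝕋 with arclength |J| ≤ 1/8, every integer λ, and every c ∈ L¹(𝕋) supported in the arc 2J, setting N := ⌊|J|^{-1}⌋ and p_λ(x) := e^{iλx} K_N(x), one has |(c ∗ p_λ)(x)| ≤ C₀ ‖c‖_{L¹(𝕋)} |J|^{-1} [M_c(χ_J)(x)]² for all x ∈ 𝕋. -/

import Mathlib

open MeasureTheory Real
open scoped ENNReal

noncomputable section

instance : Fact (0 < 2 * π) := ⟨by positivity⟩

/-- The torus `ℝ/(2πℤ)`. -/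
abbrev Tor := AddCircle (2 * π)

/-- The normalized Haar measure `(2π)⁻¹ dx` on the torus. -/
def haarT : Measure Tor := AddCircle.haarAddCircle

/-- Normalized convolution on the torus: `(f ∗ g)(x) = (2π)⁻¹ ∫ f(y) g(x-y) dy`. -/
def convT (f g : Tor → ℝ) (x : Tor) : ℝ := ∫ y, f y * g (x - y) ∂haarT

/-- The kernel `φ_L(x) = L (1 + L² sin²(x/2))^{-3/4}` on the torus. -/
def phi (L : ℝ) : Tor → ℝ :=
  Function.Periodic.lift (c := 2 * π)
    (f := fun x : ℝ => L * (1 + L ^ 2 * Real.sin (x / 2) ^ 2) ^ (-(3:ℝ)/4))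
    (by
      intro x
      simp only []
      have h : (x + 2 * π) / 2 = x / 2 + π := by ring
      rw [h, Real.sin_add_pi]
      ring_nf)

/-- The (open) arc of the torus with centre `c : ℝ` and arclength `ℓ`. -/
def arc (c ℓ : ℝ) : Set Tor := (fun t : ℝ => (t : Tor)) '' Set.Ioo (c - ℓ / 2) (c + ℓ / 2)

/-- The centred Hardy–Littlewood maximal operator on the torus:
`M_c g (x) = sup_{0<r≤π} r⁻¹ ∫_{|t|<r} |g(x-t)| dt`. -/
def Mc (g : Tor → ℝ) (x : Tor) : ℝ :=
  ⨆ r : Set.Ioc (0:ℝ) π, (r : ℝ)⁻¹ * ∫ t in Set.Ioo (-(r:ℝ)) (r:ℝ), |g (x - (t : Tor))|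

/-- Normalized convolution on the torus for complex-valued functions. -/
def convC (f g : Tor → ℂ) (x : Tor) : ℂ := ∫ y, f y * g (x - y) ∂haarT

/-- The Fejér kernel of order `N`: `K_N(x) = Σ_{|j|≤N} (1 - |j|/(N+1)) e^{ijx}`. -/
def Fejer (N : ℕ) (x : Tor) : ℂ :=
  ∑ j ∈ Finset.Icc (-(N:ℤ)) (N:ℤ), ((1 - |(j:ℝ)| / (N + 1) : ℝ) : ℂ) * fourier j x

lemma isOpen_arc (c ℓ : ℝ) : IsOpen (arc c ℓ) :=
  QuotientAddGroup.isOpenMap_coe _ isOpen_Ioo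

/-- The indicator function of an arc averages to at most `2` in the sense of `Mc`. -/
lemma bddAbove_Mc_indicator_arc (ctr ℓ : ℝ) (x : Tor) :
    BddAbove (Set.range fun r : Set.Ioc (0:ℝ) π =>
      (r : ℝ)⁻¹ * ∫ t in Set.Ioo (-(r:ℝ)) (r:ℝ),
        |(arc ctr ℓ).indicator (fun _ => (1:ℝ)) (x - (t : Tor))|) := by
  refine ⟨2, ?_⟩
  rintro _ ⟨⟨r, hr0, hrπ⟩, rfl⟩
  have h := norm_setIntegral_le_of_norm_le_const (μ := volume) (C := 1)
    (s := Set.Ioo (-r) r)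
    (f := fun t : ℝ => |(arc ctr ℓ).indicator (fun _ => (1:ℝ)) (x - (t : Tor))|)
    (by simp) (fun t _ => by
      by_cases ht : x - (t : Tor) ∈ arc ctr ℓ <;> simp [ht])
  have hv : volume.real (Set.Ioo (-r) r) = 2 * r := by
    rw [Real.volume_real_Ioo_of_le (by linarith)]; ring
  rw [hv, one_mul] at h
  have h' := (le_abs_self _).trans h
  simp only
  rw [inv_mul_le_iff₀ hr0]
  linarith

/-- Pointwise lower bound for the maximal function of the indicator of an arc. -/
lemma le_Mc_indicator_arc {ctr ℓ s : ℝ} (hℓ : 0 < ℓ) (hℓπ : ℓ ≤ π) (hs : |s| ≤ π) :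
    ℓ / (2 * |s| + ℓ) ≤ Mc ((arc ctr ℓ).indicator fun _ => (1:ℝ)) ((ctr + s : ℝ) : Tor) := by
  obtain ⟨a, ha1, ha2, ha⟩ : ∃ a : ℝ, s - ℓ / 2 ≤ a ∧ a ≤ s ∧
      (0 ≤ s ∧ a = s - ℓ / 2 ∨ s < 0 ∧ a = s) := by
    rcases le_or_gt 0 s with h | h
    · exact ⟨s - ℓ / 2, le_rfl, by linarith, .inl ⟨h, rfl⟩⟩
    · exact ⟨s, by linarith, le_rfl, .inr ⟨h, rfl⟩⟩
  set r := min π (|s| + ℓ / 2) with hr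
  have hr0 : 0 < r := lt_min pi_pos (by positivity)
  have hsub : Set.Ioo a (a + ℓ / 2) ⊆ Set.Ioo (-r) r := by
    apply Set.Ioo_subset_Ioo
    · rw [neg_le, hr, le_min_iff]
      rcases ha with ⟨h, rfl⟩ | ⟨h, rfl⟩
      · rw [abs_of_nonneg h]; constructor <;> linarith
      · rw [abs_of_neg h] at hs ⊢; constructor <;> linarith
    · rw [hr, le_min_iff]
      rcases ha with ⟨h, rfl⟩ | ⟨h, rfl⟩
      · rw [abs_of_nonneg h] at hs ⊢; constructor <;> linarith
      · rw [abs_of_neg h]; constructor <;> linarith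
  let f : ℝ → ℝ := fun t =>
    |(arc ctr ℓ).indicator (fun _ => (1:ℝ)) (((ctr + s : ℝ) : Tor) - (t : Tor))|
  have hf1 : ∀ t, ‖f t‖ ≤ 1 := fun t => by
    by_cases ht : ((ctr + s : ℝ) : Tor) - (t : Tor) ∈ arc ctr ℓ <;>
      simp only [f, Set.indicator_of_mem, Set.indicator_of_notMem, ht, not_false_eq_true] <;> simp
  have hfm : Measurable f := by
    have h1 : Measurable ((arc ctr ℓ).indicator (fun _ => (1:ℝ))) :=
      measurable_const.indicator (isOpen_arc ctr ℓ).measurableSet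
    have h2 : Continuous fun t : ℝ => ((ctr + s : ℝ) : Tor) - (t : Tor) := by
      have h : Continuous fun t : ℝ => (t : Tor) := AddCircle.continuous_mk' _
      fun_prop
    exact (h1.comp h2.measurable).abs
  have hfi : IntegrableOn f (Set.Ioo (-r) r) :=
    Measure.integrableOn_of_bounded (M := 1) (by simp) hfm.aestronglyMeasurable
      (Filter.Eventually.of_forall hf1)
  have hint : ℓ / 2 ≤ ∫ t in Set.Ioo (-r) r, f t := by
    calc ℓ / 2 = ∫ t in Set.Ioo a (a + ℓ / 2), (1 : ℝ) := by
          rw [setIntegral_const, Real.volume_real_Ioo_of_le (by linarith)]; simp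
      _ = ∫ t in Set.Ioo a (a + ℓ / 2), f t := by
          refine setIntegral_congr_fun measurableSet_Ioo fun t ht => ?_
          have hmem : ((ctr + s : ℝ) : Tor) - (t : Tor) ∈ arc ctr ℓ := by
            refine ⟨ctr + s - t, ⟨?_, ?_⟩, AddCircle.coe_sub _ _ _⟩
            · linarith [ht.2]
            · linarith [ht.1]
          simp only [f, Set.indicator_of_mem hmem, abs_one]
      _ ≤ _ := setIntegral_mono_set hfi
          (Filter.Eventually.of_forall fun t => abs_nonneg _) hsub.eventuallyLE
  have hle := le_ciSup (bddAbove_Mc_indicator_arc ctr ℓ ((ctr + s : ℝ) : Tor))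
    ⟨r, hr0, min_le_left _ _⟩
  refine le_trans ?_ hle
  calc ℓ / (2 * |s| + ℓ) = (|s| + ℓ / 2)⁻¹ * (ℓ / 2) := by
        have : 0 < |s| + ℓ / 2 := by positivity
        field_simp
    _ ≤ r⁻¹ * ∫ t in Set.Ioo (-r) r, f t :=
        mul_le_mul (inv_anti₀ hr0 (min_le_right _ _)) hint (by positivity) (by positivity)

lemma norm_fourier (n : ℤ) (x : Tor) : ‖fourier n x‖ = 1 := by
  rw [fourier_apply, Circle.norm_coe]

lemma norm_Fejer_le (N : ℕ) (x : Tor) : ‖Fejer N x‖ ≤ 2 * N + 1 := by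
  calc ‖Fejer N x‖ ≤ ∑ j ∈ Finset.Icc (-(N:ℤ)) (N:ℤ), (1 : ℝ) := by
        refine norm_sum_le_of_le _ fun j hj => ?_
        rw [norm_mul, norm_fourier, mul_one, Complex.norm_real, Real.norm_eq_abs]
        have hj' : |(j:ℝ)| ≤ N := by
          have := abs_le.2 (Finset.mem_Icc.1 hj)
          exact_mod_cast this
        have h1 : |(j:ℝ)| / (N + 1) ≤ 1 := by
          rw [div_le_one (by positivity)]; linarith
        have h0 : 0 ≤ |(j:ℝ)| / (N + 1) := by positivity
        rw [abs_le]; constructor <;> linarith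
    _ = 2 * N + 1 := by
        rw [Finset.sum_const, Int.card_Icc, nsmul_eq_mul, mul_one]
        have : ((N : ℤ) + 1 - -(N : ℤ)).toNat = 2 * N + 1 := by omega
        rw [this]; push_cast; ring

lemma sum_Icc_neg_succ {M : Type*} [AddCommMonoid M] (f : ℤ → M) (N : ℕ) :
    ∑ j ∈ Finset.Icc (-((N + 1 : ℕ) : ℤ)) ((N + 1 : ℕ) : ℤ), f j =
      f (N + 1) + (f (-(N + 1)) + ∑ j ∈ Finset.Icc (-(N : ℤ)) (N : ℤ), f j) := by
  have h : Finset.Icc (-((N + 1 : ℕ) : ℤ)) ((N + 1 : ℕ) : ℤ) =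
      insert ((N : ℤ) + 1) (insert (-((N : ℤ) + 1)) (Finset.Icc (-(N : ℤ)) (N : ℤ))) := by
    ext j; simp only [Finset.mem_insert, Finset.mem_Icc]; omega
  rw [h, Finset.sum_insert, Finset.sum_insert] <;>
    simp only [Finset.mem_insert, Finset.mem_Icc] <;> omega

/-- Closed form of the Dirichlet sum. -/
lemma sum_zpow_Icc_mul (z : ℂ) (hz : z ≠ 0) (N : ℕ) :
    (∑ j ∈ Finset.Icc (-(N:ℤ)) (N:ℤ), z ^ j) * (2 - z - z⁻¹) =
      z ^ (-(N:ℤ)) + z ^ (N:ℤ) - z ^ (N + 1 : ℤ) - z ^ (-(N + 1) : ℤ) := by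
  induction N with
  | zero => simp; ring
  | succ N ih =>
    rw [sum_Icc_neg_succ (fun j => z ^ j), add_mul, add_mul, ih]
    simp only [Nat.cast_add, Nat.cast_one, zpow_neg, zpow_add₀ hz, zpow_natCast, zpow_one, mul_inv]
    field_simp
    ring

/-- Closed form of the unnormalised Fejér sum. -/
lemma sum_triangle_zpow_Icc_mul (z : ℂ) (hz : z ≠ 0) (N : ℕ) :
    (∑ j ∈ Finset.Icc (-(N:ℤ)) (N:ℤ), ((N + 1 - |(j:ℝ)| : ℝ) : ℂ) * z ^ j) * (2 - z - z⁻¹) =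
      2 - z ^ (N + 1 : ℤ) - z ^ (-(N + 1) : ℤ) := by
  induction N with
  | zero => simp
  | succ N ih =>
    have hstep : ∑ j ∈ Finset.Icc (-((N + 1 : ℕ) : ℤ)) ((N + 1 : ℕ) : ℤ),
        ((((N + 1 : ℕ) : ℝ) + 1 - |(j:ℝ)| : ℝ) : ℂ) * z ^ j =
        (∑ j ∈ Finset.Icc (-(N:ℤ)) (N:ℤ), ((N + 1 - |(j:ℝ)| : ℝ) : ℂ) * z ^ j) +
        ∑ j ∈ Finset.Icc (-((N + 1 : ℕ) : ℤ)) ((N + 1 : ℕ) : ℤ), z ^ j := by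
      have hz' : ∑ j ∈ Finset.Icc (-(N:ℤ)) (N:ℤ), ((N + 1 - |(j:ℝ)| : ℝ) : ℂ) * z ^ j =
          ∑ j ∈ Finset.Icc (-((N + 1 : ℕ) : ℤ)) ((N + 1 : ℕ) : ℤ),
            ((N + 1 - |(j:ℝ)| : ℝ) : ℂ) * z ^ j := by
        rw [sum_Icc_neg_succ]
        have h : |(N : ℝ) + 1| = N + 1 := abs_of_nonneg (by positivity)
        have h' : |-1 + -(N : ℝ)| = N + 1 := by rw [← h, ← abs_neg]; ring_nf
        simp [h, h']
      rw [hz', ← Finset.sum_add_distrib]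
      refine Finset.sum_congr rfl fun j _ => ?_
      push_cast; ring
    rw [hstep, add_mul, ih, sum_zpow_Icc_mul z hz]
    push_cast
    ring

/-- The decay estimate for the Fejér kernel. -/
lemma norm_Fejer_mul_sin_sq_le (N : ℕ) (v : ℝ) :
    ‖Fejer N (v : Tor)‖ * ((N + 1) * Real.sin (v / 2) ^ 2) ≤ 1 := by
  set z : ℂ := Complex.exp (v * Complex.I) with hzdef
  have hz : z ≠ 0 := Complex.exp_ne_zero _
  have hzn : ‖z‖ = 1 := Complex.norm_exp_ofReal_mul_I v
  have hfour : ∀ j : ℤ, fourier j (v : Tor) = z ^ j := fun j => by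
    rw [fourier_coe_apply, hzdef, ← Complex.exp_int_mul]
    congr 1
    have : (π : ℂ) ≠ 0 := by exact_mod_cast pi_ne_zero
    push_cast
    field_simp
  have hF : (N + 1 : ℂ) * Fejer N (v : Tor) =
      ∑ j ∈ Finset.Icc (-(N:ℤ)) (N:ℤ), ((N + 1 - |(j:ℝ)| : ℝ) : ℂ) * z ^ j := by
    rw [Fejer, Finset.mul_sum]
    refine Finset.sum_congr rfl fun j _ => ?_
    rw [hfour, ← mul_assoc]
    congr 1
    have : (N + 1 : ℂ) ≠ 0 := by exact_mod_cast N.succ_ne_zero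
    push_cast
    field_simp
  have hsin : 2 - z - z⁻¹ = ((4 * Real.sin (v / 2) ^ 2 : ℝ) : ℂ) := by
    have h1 : Real.sin (v / 2) ^ 2 = 1 / 2 - Real.cos v / 2 := by
      rw [Real.sin_sq_eq_half_sub]; ring_nf
    have h2 : z + z⁻¹ = 2 * Complex.cos v := by
      rw [Complex.two_cos, hzdef, ← Complex.exp_neg, neg_mul]
    rw [h1]; push_cast
    linear_combination -h2
  have key := congrArg norm (sum_triangle_zpow_Icc_mul z hz N)
  rw [← hF, hsin, norm_mul, norm_mul, Complex.norm_real, Real.norm_of_nonneg (by positivity)] at key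
  have hN : ‖(N + 1 : ℂ)‖ = N + 1 := by
    exact_mod_cast Complex.norm_natCast (N + 1)
  have hR : ‖2 - z ^ (N + 1 : ℤ) - z ^ (-(N + 1) : ℤ)‖ ≤ 4 := by
    refine (norm_sub_le _ _).trans ?_
    have := norm_sub_le (2 : ℂ) (z ^ (N + 1 : ℤ))
    rw [norm_zpow, hzn, one_zpow, Complex.norm_ofNat] at this
    rw [norm_zpow, hzn, one_zpow]
    linarith
  rw [hN] at key
  linarith

/-- A lower bound for `|sin|` slightly beyond `[-π/2, π/2]`. -/
lemma abs_le_pi_mul_abs_sin {v : ℝ} (hv : |v| ≤ 2) : |v| ≤ π * |Real.sin v| := by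
  have hs : |Real.sin v| = |Real.sin (|v|)| := by
    rcases abs_cases v with ⟨h, _⟩ | ⟨h, _⟩ <;> simp [h]
  rw [hs]
  have h0 := abs_nonneg v
  generalize |v| = w at *
  have h1 : 2 / π * (w / 2) ≤ Real.sin (w / 2) :=
    Real.mul_le_sin (by positivity) (by linarith [pi_gt_three])
  have h2 : 1 / 2 ≤ Real.cos (w / 2) := by
    have := Real.one_sub_sq_div_two_le_cos (x := w / 2)
    nlinarith
  have h3 : w ≤ π * Real.sin (w / 2) := by
    have h := mul_le_mul_of_nonneg_left h1 pi_pos.le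
    have e : π * (2 / π * (w / 2)) = w := by field_simp
    linarith
  have h4 : Real.sin w = 2 * Real.sin (w / 2) * Real.cos (w / 2) := by
    rw [← Real.sin_two_mul]; ring_nf
  have h5 : 0 ≤ π * Real.sin (w / 2) := h0.trans h3
  calc w ≤ π * Real.sin w := by rw [h4]; nlinarith
    _ ≤ π * |Real.sin w| := by gcongr; exact le_abs_self _

/-- The Fejér kernel of order `⌊ℓ⁻¹⌋` at distance comparable to `|s|`. -/
lemma norm_Fejer_floor_le {ℓ s u : ℝ} (hℓ : 0 < ℓ) (hℓ' : ℓ ≤ 1 / 8) (hs : |s| ≤ π)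
    (hu : |u| ≤ ℓ) :
    ‖Fejer (Nat.floor ℓ⁻¹) ((s - u : ℝ) : Tor)‖ ≤ 2000 * ℓ / (2 * |s| + ℓ) ^ 2 := by
  set N := Nat.floor ℓ⁻¹ with hN
  have hs0 := abs_nonneg s
  rw [le_div_iff₀ (by positivity)]
  rcases le_or_gt |s| (2 * ℓ) with h | h
  · have h1 : (N : ℝ) ≤ ℓ⁻¹ := Nat.floor_le (by positivity)
    have h2 : 1 ≤ ℓ⁻¹ := by rw [one_le_inv₀ hℓ]; linarith
    have h3 : ‖Fejer N ((s - u : ℝ) : Tor)‖ ≤ 3 * ℓ⁻¹ := by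
      linarith [norm_Fejer_le N ((s - u : ℝ) : Tor)]
    have h4 : (2 * |s| + ℓ) ^ 2 ≤ 25 * ℓ ^ 2 := by nlinarith
    calc _ ≤ 3 * ℓ⁻¹ * (25 * ℓ ^ 2) := by gcongr
      _ = 75 * ℓ := by field_simp; norm_num
      _ ≤ 2000 * ℓ := by linarith
  · have hlow : |s| / 2 ≤ |s - u| := by linarith [abs_sub_abs_le_abs_sub s u]
    have hup : |s - u| ≤ 4 := by linarith [abs_sub s u, pi_lt_d2]
    have hv : |(s - u) / 2| = |s - u| / 2 := by rw [abs_div, abs_two]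
    have hsin := abs_le_pi_mul_abs_sin (v := (s - u) / 2) (by rw [hv]; linarith)
    rw [hv] at hsin
    have h1 : |s| ≤ 16 * |Real.sin ((s - u) / 2)| := by
      nlinarith [abs_nonneg (Real.sin ((s - u) / 2)), pi_lt_d2]
    have h2 : (2 * |s| + ℓ) ^ 2 ≤ 1600 * Real.sin ((s - u) / 2) ^ 2 := by
      rw [← sq_abs (Real.sin _)]
      have : 2 * |s| + ℓ ≤ 40 * |Real.sin ((s - u) / 2)| := by linarith
      calc _ ≤ (40 * |Real.sin ((s - u) / 2)|) ^ 2 := by gcongr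
        _ = _ := by ring
    have h3 := norm_Fejer_mul_sin_sq_le N (s - u)
    have h4 : 1 ≤ ℓ * (N + 1) := by
      have := (Nat.lt_floor_add_one ℓ⁻¹).le
      calc 1 = ℓ * ℓ⁻¹ := by field_simp
        _ ≤ _ := by gcongr
    set F := ‖Fejer N ((s - u : ℝ) : Tor)‖
    calc F * (2 * |s| + ℓ) ^ 2 ≤ F * (1600 * Real.sin ((s - u) / 2) ^ 2) * 1 := by
          rw [mul_one]; gcongr
      _ ≤ F * (1600 * Real.sin ((s - u) / 2) ^ 2) * (ℓ * (N + 1)) := by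
          have : 0 ≤ F := norm_nonneg _
          gcongr
      _ = 1600 * ℓ * (F * ((N + 1) * Real.sin ((s - u) / 2) ^ 2)) := by ring
      _ ≤ 1600 * ℓ * 1 := by gcongr
      _ ≤ 2000 * ℓ := by linarith

/-- There is an absolute constant `C₀ > 0` such that for every arc `J` with `|J| ≤ 1/8`,
every integer `λ` and every `c ∈ L¹(𝕋)` supported in `2J`, setting `N = ⌊|J|⁻¹⌋` and
`p_λ(x) = e^{iλx} K_N(x)`, one has
`|(c ∗ p_λ)(x)| ≤ C₀ ‖c‖_{L¹} |J|⁻¹ (M_c χ_J (x))²` for all `x ∈ 𝕋`. -/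
theorem statement12 :
    ∃ C₀ : ℝ, 0 < C₀ ∧
      ∀ (ctr ℓ : ℝ), 0 < ℓ → ℓ ≤ 1 / 8 →
      ∀ lam : ℤ,
      ∀ c : Tor → ℂ, Integrable c haarT →
        (∀ x : Tor, x ∉ arc ctr (2 * ℓ) → c x = 0) →
        ∀ x : Tor,
          ‖convC c (fun y => fourier lam y * Fejer (Nat.floor ℓ⁻¹) y) x‖ ≤
            C₀ * (∫ y, ‖c y‖ ∂haarT) * ℓ⁻¹ *
              (Mc ((arc ctr ℓ).indicator fun _ => (1:ℝ)) x) ^ 2 := by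
  refine ⟨2000, by norm_num, fun ctr ℓ hℓ hℓ' lam c hc hsupp x => ?_⟩
  obtain ⟨t, ht, rfl⟩ : x ∈ ((↑) : ℝ → Tor) '' Set.Ioc (ctr - π) (ctr - π + 2 * π) := by
    rw [AddCircle.coe_image_Ioc_eq]; trivial
  obtain ⟨s, rfl⟩ : ∃ s, t = ctr + s := ⟨t - ctr, by ring⟩
  have hs : |s| ≤ π := abs_le.2 ⟨by linarith [ht.1], by linarith [ht.2]⟩
  have hpt : ∀ y : Tor, ‖c y * (fourier lam (((ctr + s : ℝ) : Tor) - y) *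
      Fejer (Nat.floor ℓ⁻¹) (((ctr + s : ℝ) : Tor) - y))‖ ≤
      ‖c y‖ * (2000 * ℓ / (2 * |s| + ℓ) ^ 2) := fun y => by
    by_cases hy : y ∈ arc ctr (2 * ℓ)
    · obtain ⟨w, hw, rfl⟩ := hy
      have hsub : ((ctr + s : ℝ) : Tor) - (w : Tor) = ((s - (w - ctr) : ℝ) : Tor) := by
        rw [← AddCircle.coe_sub]; congr 1; ring
      simp only
      rw [norm_mul, norm_mul, norm_fourier, one_mul, hsub]
      gcongr
      exact norm_Fejer_floor_le hℓ hℓ' hs (abs_le.2 ⟨by linarith [hw.1], by linarith [hw.2]⟩)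
    · simp [hsupp y hy]
  have hM := le_Mc_indicator_arc (ctr := ctr) hℓ (by linarith [pi_gt_three]) hs
  have hI : 0 ≤ ∫ y, ‖c y‖ ∂haarT := integral_nonneg fun _ => norm_nonneg _
  calc _ ≤ ∫ y, ‖c y‖ * (2000 * ℓ / (2 * |s| + ℓ) ^ 2) ∂haarT :=
        norm_integral_le_of_norm_le (hc.norm.mul_const _) (Filter.Eventually.of_forall hpt)
    _ = 2000 * (∫ y, ‖c y‖ ∂haarT) * ℓ⁻¹ * (ℓ / (2 * |s| + ℓ)) ^ 2 := by
        rw [integral_mul_const]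
        have : 0 < 2 * |s| + ℓ := by positivity
        field_simp
    _ ≤ _ := by gcongr

end
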